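/- (Etingof–Gelaki) Let H be a Hopf algebra over a field k and let A be a left H-Galois object. Then A is cleft if and only if the fibre functor Ω^A : Comod_f(H) → Vect_f(k), V ↦ V □_H A, preserves the dimensions of the underlying vector spaces, i.e. dim_k (V □_H A) = dim_k V for every finite-dimensional right H-comodule V. -/

import Mathlib

open TensorProduct

universe u

namespace HopfGalois

variable (k : Type u) [CommRing k]

section Coactions

variable (H : Type u) [Ring H] [Bialgebra k H]
variable {V : Type u} [AddCommGroup V] [Module k V]

/-- `ρ : V → V ⊗ H` is a (coassociative, counital) right `H`-coaction. -/
structure IsRightCoaction (ρ : V →ₗ[k] V ⊗[k] H) : Prop where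
  coassoc : (TensorProduct.assoc k V H H).toLinearMap ∘ₗ ρ.rTensor H ∘ₗ ρ
      = (Coalgebra.comul (R := k) (A := H)).lTensor V ∘ₗ ρ
  counit : (TensorProduct.rid k V).toLinearMap ∘ₗ
      (Coalgebra.counit (R := k) (A := H)).lTensor V ∘ₗ ρ = LinearMap.id

/-- `lam : V → H ⊗ V` is a (coassociative, counital) left `H`-coaction. -/
structure IsLeftCoaction (lam : V →ₗ[k] H ⊗[k] V) : Prop where
  coassoc : lam.lTensor H ∘ₗ lam
      = (TensorProduct.assoc k H H V).toLinearMap ∘ₗ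
          (Coalgebra.comul (R := k) (A := H)).rTensor V ∘ₗ lam
  counit : (TensorProduct.lid k V).toLinearMap ∘ₗ
      (Coalgebra.counit (R := k) (A := H)).rTensor V ∘ₗ lam = LinearMap.id

end Coactions

section ComoduleAlgebras

variable (H : Type u) [Ring H] [Bialgebra k H]
variable (A : Type u) [Ring A] [Algebra k A]

/-- `α : A → H ⊗ A` makes the `k`-algebra `A` a left `H`-comodule algebra. -/
structure IsLeftComoduleAlgebra (α : A →ₗ[k] H ⊗[k] A) : Prop where
  coaction : IsLeftCoaction k H α
  map_one : α 1 = 1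
  map_mul : ∀ a b : A, α (a * b) = α a * α b

/-- `β : A → A ⊗ H` makes the `k`-algebra `A` a right `H`-comodule algebra. -/
structure IsRightComoduleAlgebra (β : A →ₗ[k] A ⊗[k] H) : Prop where
  coaction : IsRightCoaction k H β
  map_one : β 1 = 1
  map_mul : ∀ a b : A, β (a * b) = β a * β b

/-- The canonical (Galois) map `A ⊗ A → H ⊗ A`, `a ⊗ b ↦ a₍₋₁₎ ⊗ a₍₀₎b`,
associated to a left coaction `α`. -/
noncomputable def leftCanonicalMap (α : A →ₗ[k] H ⊗[k] A) :
    A ⊗[k] A →ₗ[k] H ⊗[k] A :=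
  (LinearMap.mul' k A).lTensor H ∘ₗ (TensorProduct.assoc k H A A).toLinearMap ∘ₗ α.rTensor A

/-- The canonical (Galois) map `A ⊗ A → A ⊗ H`, `a ⊗ b ↦ ab₍₀₎ ⊗ b₍₁₎`,
associated to a right coaction `β`. -/
noncomputable def rightCanonicalMap (β : A →ₗ[k] A ⊗[k] H) :
    A ⊗[k] A →ₗ[k] A ⊗[k] H :=
  (LinearMap.mul' k A).rTensor H ∘ₗ (TensorProduct.assoc k A A H).symm.toLinearMap ∘ₗ β.lTensor A

/-- A left `H`-Galois object structure: a nonzero left `H`-comodule algebra whose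
canonical map is bijective. -/
structure IsLeftGaloisObject (α : A →ₗ[k] H ⊗[k] A) : Prop where
  comodAlg : IsLeftComoduleAlgebra k H A α
  nontrivial : Nontrivial A
  bijective : Function.Bijective (leftCanonicalMap k H A α)

/-- A right `H`-Galois object structure. -/
structure IsRightGaloisObject (β : A →ₗ[k] A ⊗[k] H) : Prop where
  comodAlg : IsRightComoduleAlgebra k H A β
  nontrivial : Nontrivial A
  bijective : Function.Bijective (rightCanonicalMap k H A β)

end ComoduleAlgebras

section Colinear

variable {k} (H : Type u) [Ring H] [Bialgebra k H]
variable {A B : Type u} [AddCommGroup A] [Module k A] [AddCommGroup B] [Module k B]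

/-- A linear map between left `H`-comodules is `H`-colinear. -/
def IsLeftColinear (α : A →ₗ[k] H ⊗[k] A) (α' : B →ₗ[k] H ⊗[k] B) (f : A →ₗ[k] B) : Prop :=
  α' ∘ₗ f = f.lTensor H ∘ₗ α

/-- A linear map between right `H`-comodules is `H`-colinear. -/
def IsRightColinear (β : A →ₗ[k] A ⊗[k] H) (β' : B →ₗ[k] B ⊗[k] H) (f : A →ₗ[k] B) : Prop :=
  β' ∘ₗ f = f.rTensor H ∘ₗ β

end Colinear

section Cotensor

variable {k}
variable (C : Type u) [AddCommGroup C] [Module k C]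
variable {V W : Type u} [AddCommGroup V] [Module k V] [AddCommGroup W] [Module k W]

/-- The cotensor product `V □_C W` of a right `C`-comodule and a left `C`-comodule,
as a submodule of `V ⊗ W`: the kernel of `ρ ⊗ 1 - 1 ⊗ lam`. -/
noncomputable def cotensor (ρ : V →ₗ[k] V ⊗[k] C) (lam : W →ₗ[k] C ⊗[k] W) :
    Submodule k (V ⊗[k] W) :=
  LinearMap.ker (ρ.rTensor W -
    (TensorProduct.assoc k V C W).symm.toLinearMap ∘ₗ lam.lTensor V)

end Cotensor

end HopfGalois

open HopfGalois

namespace HopfGalois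

section Modules

/-- Partially defined injective linear maps have a maximal element. -/
lemma exists_maximal_injective {R M N : Type*} [Ring R] [AddCommGroup M] [Module R M]
    [AddCommGroup N] [Module R N] :
    ∃ f : M →ₗ.[R] N, Maximal (fun g : M →ₗ.[R] N => Function.Injective g.toFun) f := by
  refine zorn_le₀ {g : M →ₗ.[R] N | Function.Injective g.toFun} fun c hc hchain => ?_
  rcases c.eq_empty_or_nonempty with rfl | hne
  · refine ⟨⊥, ?_, by simp⟩
    intro x y _
    exact Subtype.ext (((Submodule.mem_bot R).1 x.2).trans ((Submodule.mem_bot R).1 y.2).symm)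
  · have hdir := hchain.directedOn
    refine ⟨LinearPMap.sSup c hdir, ?_, fun z hz => LinearPMap.le_sSup hdir hz⟩
    refine (injective_iff_map_eq_zero _).2 fun x hx => ?_
    obtain ⟨f, hf, hxf⟩ := (LinearPMap.mem_domain_sSup_iff hne hdir).1 x.2
    have h0 : f ⟨x, hxf⟩ = LinearPMap.sSup c hdir x := (LinearPMap.le_sSup hdir hf).2 rfl
    have h1 := (injective_iff_map_eq_zero _).1 (hc hf) ⟨x, hxf⟩ (h0.trans hx)
    have h2 : (x : M) = 0 := congrArg Subtype.val h1
    exact Subtype.ext h2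

variable {k R S M N : Type*} [Field k] [Ring R] [Algebra k R]
  [AddCommGroup S] [Module R S]
  [AddCommGroup M] [Module k M] [Module R M] [IsScalarTower k R M]
  [AddCommGroup N] [Module k N] [Module R N] [IsScalarTower k R N]

variable (k S) in
/-- Postcomposition with an `R`-linear map, as a `k`-linear map between spaces of `R`-linear
maps. -/
def postcomp (f : M →ₗ[R] N) : (S →ₗ[R] M) →ₗ[k] (S →ₗ[R] N) where
  toFun u := f ∘ₗ u
  map_add' u v := LinearMap.comp_add u v f
  map_smul' c u := by
    ext s
    exact f.map_smul_of_tower c (u s)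

lemma postcomp_injective {f : M →ₗ[R] N} (hf : Function.Injective f) :
    Function.Injective (postcomp k S f) := fun u v h => by
  ext s
  exact hf (LinearMap.congr_fun h s)

/-- An injective `f : M → N` with `Hom_R(S, M)` and `Hom_R(S, N)` of equal positive dimension
induces a surjection on `Hom_R(S, -)`. -/
lemma postcomp_surjective {f : M →ₗ[R] N} (hf : Function.Injective f)
    (h : Module.finrank k (S →ₗ[R] M) = Module.finrank k (S →ₗ[R] N))
    (hpos : 0 < Module.finrank k (S →ₗ[R] N)) :
    Function.Surjective (postcomp k S f) := by
  have := Module.finite_of_finrank_pos hpos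
  have := Module.finite_of_finrank_pos (h ▸ hpos)
  exact (LinearMap.injective_iff_surjective_of_finrank_eq_finrank h).1 (postcomp_injective hf)

/-- A nonzero submodule of a locally finite module contains a finite-dimensional simple one. -/
lemma exists_simple_le (hM : ∀ m : M, ∃ T : Submodule R M, m ∈ T ∧ Module.Finite k T)
    {K : Submodule R M} (hK : K ≠ ⊥) :
    ∃ T ≤ K, IsSimpleModule R T ∧ Module.Finite k T := by
  obtain ⟨x, hxK, hx⟩ := K.ne_bot_iff.1 hK
  obtain ⟨T, hxT, hT⟩ := hM x
  have : IsArtinian R T := isArtinian_of_tower k inferInstance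
  have hlt : WellFounded fun P Q : Submodule R T => P < Q := wellFounded_lt
  have := isAtomic_of_orderBot_wellFounded_lt hlt
  have hne : K.comap T.subtype ≠ ⊥ := fun h => hx <| by
    have : (⟨x, hxT⟩ : T) ∈ K.comap T.subtype := hxK
    rw [h, Submodule.mem_bot] at this
    exact congrArg Subtype.val this
  obtain ⟨U, hU, hUK⟩ := (eq_bot_or_exists_atom_le (K.comap T.subtype)).resolve_left hne
  have := isSimpleModule_iff_isAtom.2 hU
  let e := Submodule.equivMapOfInjective T.subtype T.subtype_injective U
  refine ⟨U.map T.subtype, Submodule.map_le_iff_le_comap.2 hUK, IsSimpleModule.congr e.symm, ?_⟩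
  have : Module.Finite k U :=
    Module.Finite.of_injective (U.subtype.restrictScalars k) U.subtype_injective
  exact Module.Finite.equiv (e.restrictScalars k)

/-- Two locally finite modules with the same multiplicities of finite-dimensional modules are
isomorphic, provided that partially defined maps extend. -/
theorem exists_bijective_of_finrank_hom
    (hM : ∀ m : M, ∃ T : Submodule R M, m ∈ T ∧ Module.Finite k T)
    (hN : ∀ n : N, ∃ T : Submodule R N, n ∈ T ∧ Module.Finite k T)
    (hext : ∀ (P : Submodule R M) (f : P →ₗ[R] N), ∃ F : M →ₗ[R] N, F ∘ₗ P.subtype = f)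
    (hMM : ∀ T : Submodule R M, Module.Finite k T →
      Module.finrank k (T →ₗ[R] M) = Module.finrank k T)
    (hMN : ∀ T : Submodule R M, Module.Finite k T →
      Module.finrank k (T →ₗ[R] N) = Module.finrank k T)
    (hNM : ∀ T : Submodule R N, Module.Finite k T →
      Module.finrank k (T →ₗ[R] M) = Module.finrank k T)
    (hNN : ∀ T : Submodule R N, Module.Finite k T →
      Module.finrank k (T →ₗ[R] N) = Module.finrank k T) :
    ∃ F : M →ₗ[R] N, Function.Bijective F := by
  obtain ⟨f, hf, hmax⟩ := exists_maximal_injective (R := R) (M := M) (N := N)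
  obtain ⟨F, hF⟩ := hext f.domain f.toFun
  have hFf : ∀ x : f.domain, F x = f x := fun x => LinearMap.congr_fun hF x
  have hinj : Function.Injective F := by
    rw [← LinearMap.ker_eq_bot]
    by_contra hker
    obtain ⟨T, hTK, hT, hTfin⟩ := exists_simple_le hM hker
    have := hT.nontrivial
    have hdisj : ∀ x : f.domain, (x : M) ∈ T → x = 0 := fun x hx =>
      (injective_iff_map_eq_zero _).1 hf x ((hFf x).symm.trans (hTK hx))
    have hpos : 0 < Module.finrank k T := Module.finrank_pos
    -- some `g : T → N` does not factor through `f`, as `Hom_R(T, N)` is too large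
    have hg : ∃ g : T →ₗ[R] N, ¬ LinearMap.range g ≤ LinearMap.range f.toFun := by
      by_contra! hall
      have hsurj : Function.Surjective (postcomp k T f.toFun) := fun g => by
        let e := LinearEquiv.ofInjective f.toFun hf
        refine ⟨e.symm ∘ₗ g.codRestrict (LinearMap.range f.toFun)
          fun t => hall g ⟨t, rfl⟩, ?_⟩
        ext t
        exact congrArg Subtype.val (e.apply_symm_apply ⟨g t, hall g ⟨t, rfl⟩⟩)
      have h1 := (LinearEquiv.ofBijective _ ⟨postcomp_injective hf, hsurj⟩).finrank_eq
      have h2 := postcomp_surjective (k := k) (S := T) f.domain.subtype_injective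
        (by rw [h1, hMM T hTfin, hMN T hTfin]) (by rwa [hMM T hTfin])
      obtain ⟨u, hu⟩ := h2 T.subtype
      obtain ⟨t, ht⟩ := exists_ne (0 : T)
      have hut : (u t : M) = t := LinearMap.congr_fun hu t
      have := hdisj (u t) (hut ▸ t.2)
      exact ht (Subtype.ext (by rw [← hut, this]; rfl))
    obtain ⟨g, hg⟩ := hg
    have hg0 : ∀ t : T, g t ∈ LinearMap.range f.toFun → t = 0 := by
      have hcomap : (LinearMap.range f.toFun).comap g = ⊥ := by
        refine (eq_bot_or_eq_top _).resolve_right fun h => hg ?_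
        rintro _ ⟨t, rfl⟩
        exact h.ge (Submodule.mem_top : t ∈ ⊤)
      intro t ht
      have : t ∈ (LinearMap.range f.toFun).comap g := ht
      rwa [hcomap, Submodule.mem_bot] at this
    have hcompat : ∀ (x : f.domain) (y : (⟨T, g⟩ : M →ₗ.[R] N).domain),
        (x : M) = y → f x = (⟨T, g⟩ : M →ₗ.[R] N) y := fun x y hxy => by
      have hx : x = 0 := hdisj x (hxy ▸ y.2)
      have hy : y = 0 := Subtype.ext (by rw [← hxy, hx]; rfl)
      rw [hx, hy, LinearPMap.map_zero, LinearPMap.map_zero]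
    have hsup : Function.Injective (f.sup ⟨T, g⟩ hcompat).toFun := by
      refine (injective_iff_map_eq_zero _).2 fun z hz => ?_
      obtain ⟨x, hx, y, hy, hxy⟩ := Submodule.mem_sup.1 z.2
      have h := LinearPMap.sup_apply hcompat ⟨x, hx⟩ ⟨y, hy⟩ z hxy
      have h' : f ⟨x, hx⟩ + g ⟨y, hy⟩ = 0 := h.symm.trans hz
      have hy0 := hg0 ⟨y, hy⟩ ⟨-⟨x, hx⟩, by
        rw [map_neg]; exact neg_eq_of_add_eq_zero_right h'⟩
      rw [hy0, map_zero, add_zero] at h'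
      have hx0 := (injective_iff_map_eq_zero _).1 hf ⟨x, hx⟩ h'
      have hx1 : x = 0 := congrArg Subtype.val hx0
      have hy1 : y = 0 := congrArg Subtype.val hy0
      exact Subtype.ext (by rw [← hxy, hx1, hy1, add_zero]; rfl)
    have hle : T ≤ f.domain :=
      (LinearPMap.right_le_sup f ⟨T, g⟩ hcompat).1.trans
        (hmax hsup (LinearPMap.left_le_sup f ⟨T, g⟩ hcompat)).1
    obtain ⟨t, ht⟩ := exists_ne (0 : T)
    have ht0 : (t : M) = 0 := congrArg Subtype.val (hdisj ⟨t, hle t.2⟩ t.2)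
    exact ht (Subtype.ext ht0)
  refine ⟨F, hinj, fun n => ?_⟩
  by_cases hn : n = 0
  · exact ⟨0, by rw [map_zero, hn]⟩
  obtain ⟨T, hnT, hT⟩ := hN n
  have : Nontrivial T := ⟨⟨n, hnT⟩, 0, fun h => hn (congrArg Subtype.val h)⟩
  have hpos : 0 < Module.finrank k T := Module.finrank_pos
  obtain ⟨u, hu⟩ := postcomp_surjective (k := k) (S := T) hinj
    (by rw [hNM T hT, hNN T hT]) (by rwa [hNN T hT]) T.subtype
  exact ⟨u ⟨n, hnT⟩, LinearMap.congr_fun hu ⟨n, hnT⟩⟩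

end Modules

section Slices

variable {k H M N : Type u} [Field k] [AddCommGroup H] [Module k H]
  [AddCommGroup M] [Module k M] [AddCommGroup N] [Module k N]

/-- Contraction of the left tensor factor with a functional. -/
noncomputable def slice (g : Module.Dual k H) : H ⊗[k] M →ₗ[k] M :=
  (TensorProduct.lid k M).toLinearMap ∘ₗ g.rTensor M

@[simp]
lemma slice_tmul (g : Module.Dual k H) (h : H) (m : M) : slice g (h ⊗ₜ[k] m) = g h • m := by
  simp [slice]

lemma eq_of_slice_eq {x y : H ⊗[k] M} (h : ∀ g : Module.Dual k H, slice g x = slice g y) :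
    x = y := by
  classical
  let b := Module.Free.chooseBasis k H
  refine (TensorProduct.equivFinsuppOfBasisLeft b).injective (Finsupp.ext fun i => ?_)
  rw [TensorProduct.equivFinsuppOfBasisLeft_apply, TensorProduct.equivFinsuppOfBasisLeft_apply]
  exact h (b.coord i)

lemma slice_lTensor (g : Module.Dual k H) (u : M →ₗ[k] N) (x : H ⊗[k] M) :
    slice g (u.lTensor H x) = u (slice g x) := by
  induction x with
  | zero => simp
  | tmul h m => simp
  | add x y hx hy => simp [hx, hy]

lemma slice_slice_assoc (g₁ g₂ : Module.Dual k H) (x : (H ⊗[k] H) ⊗[k] M) :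
    slice g₂ (slice g₁ (TensorProduct.assoc k H H M x)) =
      slice (H := H ⊗[k] H) (g₂ ∘ₗ slice g₁) x := by
  induction x with
  | zero => simp
  | tmul w m =>
    induction w with
    | zero => simp
    | tmul h h' => simp [mul_smul]
    | add x y hx hy => simp only [TensorProduct.add_tmul, map_add, hx, hy]
  | add x y hx hy => simp only [map_add, hx, hy]

lemma slice_rTensor {H' : Type u} [AddCommGroup H'] [Module k H'] (g : Module.Dual k H)
    (u : H' →ₗ[k] H) (x : H' ⊗[k] M) : slice g (u.rTensor M x) = slice (g ∘ₗ u) x := by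
  induction x with
  | zero => simp
  | tmul h m => simp
  | add x y hx hy => simp only [map_add, hx, hy]

/-- Contraction of a fixed tensor, as a linear function of the functional. -/
noncomputable def sliceAt (x : H ⊗[k] M) : Module.Dual k H →ₗ[k] M where
  toFun g := slice g x
  map_add' g g' := by simp [slice, LinearMap.rTensor_add]
  map_smul' c g := by simp [slice, LinearMap.rTensor_smul]

@[simp]
lemma sliceAt_apply (x : H ⊗[k] M) (g : Module.Dual k H) : sliceAt x g = slice g x := rfl

lemma finite_range_sliceAt (x : H ⊗[k] M) : Module.Finite k (LinearMap.range (sliceAt x)) := by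
  induction x with
  | zero =>
    have : sliceAt (0 : H ⊗[k] M) = 0 := by ext; simp
    rw [this, LinearMap.range_zero]
    infer_instance
  | tmul h m =>
    refine Submodule.finiteDimensional_of_le (S₂ := Submodule.span k {m}) ?_
    rintro _ ⟨g, rfl⟩
    simpa using Submodule.smul_mem _ _ (Submodule.mem_span_singleton_self m)
  | add x y hx hy =>
    refine Submodule.finiteDimensional_of_le
      (S₂ := LinearMap.range (sliceAt x) ⊔ LinearMap.range (sliceAt y)) ?_
    rintro _ ⟨g, rfl⟩
    rw [sliceAt_apply, map_add]
    exact Submodule.add_mem_sup ⟨g, rfl⟩ ⟨g, rfl⟩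

lemma mem_cotensor_iff {V : Type u} [AddCommGroup V] [Module k V] (ρ : V →ₗ[k] V ⊗[k] H)
    (lam : M →ₗ[k] H ⊗[k] M) (x : V ⊗[k] M) :
    x ∈ cotensor H ρ lam ↔ TensorProduct.assoc k V H M (ρ.rTensor M x) = lam.lTensor V x := by
  rw [cotensor, LinearMap.mem_ker, LinearMap.sub_apply, sub_eq_zero]
  exact LinearEquiv.eq_symm_apply _

variable {T : Type u} [AddCommGroup T] [Module k T]

lemma dualTensorHom_lTensor (u : M →ₗ[k] N) (x : Module.Dual k T ⊗[k] M) (t : T) :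
    dualTensorHom k T N (u.lTensor _ x) t = u (dualTensorHom k T M x t) := by
  induction x with
  | zero => simp
  | tmul h m => simp
  | add x y hx hy => simp only [map_add, LinearMap.add_apply, hx, hy]

lemma slice_dualTensorHom_assoc (g : Module.Dual k H) (x : Module.Dual k T ⊗[k] H) (m : M)
    (t : T) :
    slice g (dualTensorHom k T (H ⊗[k] M) (TensorProduct.assoc k _ H M (x ⊗ₜ m)) t) =
      g (dualTensorHom k T H x t) • m := by
  induction x with
  | zero => simp
  | tmul h m => simp [mul_smul]
  | add x y hx hy => simp only [TensorProduct.add_tmul, map_add, LinearMap.add_apply, hx, hy,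
      add_smul]

end Slices

section DualCoaction

variable {k H : Type u} [Field k] [AddCommGroup H] [Module k H]
  {T : Type u} [AddCommGroup T] [Module k T] [FiniteDimensional k T]

/-- The right coaction on the dual of a finite-dimensional left comodule. -/
noncomputable def dualCoaction (lam : T →ₗ[k] H ⊗[k] T) :
    Module.Dual k T →ₗ[k] Module.Dual k T ⊗[k] H where
  toFun φ := (dualTensorHomEquiv k T H).symm
    ((TensorProduct.rid k H).toLinearMap ∘ₗ φ.lTensor H ∘ₗ lam)
  map_add' φ ψ := by
    rw [← map_add, LinearMap.lTensor_add, LinearMap.add_comp, LinearMap.comp_add]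
  map_smul' c φ := by
    rw [← map_smul, LinearMap.lTensor_smul, LinearMap.smul_comp, LinearMap.comp_smul,
      RingHom.id_apply]

lemma apply_dualTensorHom_dualCoaction (lam : T →ₗ[k] H ⊗[k] T) (g : Module.Dual k H)
    (φ : Module.Dual k T) (t : T) :
    g (dualTensorHom k T H (dualCoaction lam φ) t) = φ (slice g (lam t)) := by
  have h : dualTensorHom k T H (dualCoaction lam φ) =
      (TensorProduct.rid k H).toLinearMap ∘ₗ φ.lTensor H ∘ₗ lam :=
    (dualTensorHomEquiv k T H).apply_symm_apply _
  rw [h, LinearMap.comp_apply, LinearMap.comp_apply]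
  induction lam t with
  | zero => simp
  | tmul h m => simp [mul_comm]
  | add x y hx hy => simp only [map_add, hx, hy]

lemma slice_dualTensorHom_dualCoaction {M : Type u} [AddCommGroup M] [Module k M]
    (lam : T →ₗ[k] H ⊗[k] T) (g : Module.Dual k H) (x : Module.Dual k T ⊗[k] M) (t : T) :
    slice g (dualTensorHom k T (H ⊗[k] M)
      (TensorProduct.assoc k _ H M ((dualCoaction lam).rTensor M x)) t) =
      dualTensorHom k T M x (slice g (lam t)) := by
  induction x with
  | zero => simp
  | tmul φ m =>
    rw [LinearMap.rTensor_tmul, slice_dualTensorHom_assoc, apply_dualTensorHom_dualCoaction,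
      dualTensorHom_apply]
  | add x y hx hy => simp only [map_add, LinearMap.add_apply, hx, hy]

lemma mem_cotensor_dualCoaction_iff {M : Type u} [AddCommGroup M] [Module k M]
    (lam : T →ₗ[k] H ⊗[k] T) (α : M →ₗ[k] H ⊗[k] M) (x : Module.Dual k T ⊗[k] M) :
    x ∈ cotensor H (dualCoaction lam) α ↔ ∀ (g : Module.Dual k H) (t : T),
      dualTensorHom k T M x (slice g (lam t)) = slice g (α (dualTensorHom k T M x t)) := by
  have hiff := mem_cotensor_iff (dualCoaction lam) α x
  refine hiff.trans ?_
  simp_rw [← slice_dualTensorHom_dualCoaction, ← dualTensorHom_lTensor α]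
  refine ⟨fun h g t => by rw [h], fun h => ?_⟩
  refine (dualTensorHomEquiv k T (H ⊗[k] M)).injective (LinearMap.ext fun t => ?_)
  exact eq_of_slice_eq fun g => h g t

end DualCoaction

section Coactions

variable {k H M : Type u} [Field k] [Ring H] [Bialgebra k H] [AddCommGroup M] [Module k M]

lemma slice_slice_coaction {lam : M →ₗ[k] H ⊗[k] M} (hlam : IsLeftCoaction k H lam)
    (g₁ g₂ : Module.Dual k H) (m : M) :
    slice g₂ (lam (slice g₁ (lam m))) =
      slice (g₂ ∘ₗ slice g₁ ∘ₗ Coalgebra.comul (R := k) (A := H)) (lam m) := by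
  have h : lam.lTensor H (lam m) = TensorProduct.assoc k H H M
      ((Coalgebra.comul (R := k) (A := H)).rTensor M (lam m)) :=
    LinearMap.congr_fun hlam.coassoc m
  rw [← slice_lTensor, h, slice_slice_assoc, slice_rTensor, LinearMap.comp_assoc]

lemma slice_counit_coaction {lam : M →ₗ[k] H ⊗[k] M} (hlam : IsLeftCoaction k H lam) (m : M) :
    slice (Coalgebra.counit (R := k) (A := H)) (lam m) = m :=
  LinearMap.congr_fun hlam.counit m

lemma isRightCoaction_dualCoaction {T : Type u} [AddCommGroup T] [Module k T]
    [FiniteDimensional k T] {lam : T →ₗ[k] H ⊗[k] T}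
    (hmul : ∀ (g₁ g₂ : Module.Dual k H) (t : T), slice g₂ (lam (slice g₁ (lam t))) =
      slice (g₂ ∘ₗ slice g₁ ∘ₗ Coalgebra.comul (R := k) (A := H)) (lam t))
    (hone : ∀ t, slice (Coalgebra.counit (R := k) (A := H)) (lam t) = t) :
    IsRightCoaction k H (dualCoaction lam) where
  coassoc := by
    refine LinearMap.ext fun φ => (dualTensorHomEquiv k T (H ⊗[k] H)).injective
      (LinearMap.ext fun t => eq_of_slice_eq fun g₁ => ?_)
    refine sub_eq_zero.1 ((Module.forall_dual_apply_eq_zero_iff k _).1 fun g₂ => ?_)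
    rw [map_sub, sub_eq_zero]
    change g₂ (slice g₁ (dualTensorHom k T (H ⊗[k] H) (TensorProduct.assoc k _ H H
      ((dualCoaction lam).rTensor H (dualCoaction lam φ))) t)) =
      g₂ (slice g₁ (dualTensorHom k T (H ⊗[k] H)
        ((Coalgebra.comul (R := k) (A := H)).lTensor _ (dualCoaction lam φ)) t))
    rw [slice_dualTensorHom_dualCoaction, dualTensorHom_lTensor, apply_dualTensorHom_dualCoaction,
      hmul, ← apply_dualTensorHom_dualCoaction]
    rfl
  counit := by
    refine LinearMap.ext fun φ => LinearMap.ext fun t => ?_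
    have h : ∀ x : Module.Dual k T ⊗[k] H, TensorProduct.rid k _
        ((Coalgebra.counit (R := k) (A := H)).lTensor _ x) t =
        Coalgebra.counit (R := k) (A := H) (dualTensorHom k T H x t) := fun x => by
      induction x with
      | zero => simp
      | tmul φ m => simp [mul_comm]
      | add x y hx hy => simp only [map_add, LinearMap.add_apply, hx, hy]
    refine (h _).trans ?_
    rw [apply_dualTensorHom_dualCoaction, hone]
    rfl

lemma isLeftCoaction_comul : IsLeftCoaction k H (Coalgebra.comul (R := k) (A := H)) where
  coassoc := Coalgebra.coassoc.symm
  counit := by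
    ext h
    simp

/-- `V □_H H ≅ V`. -/
lemma finrank_cotensor_comul {V : Type u} [AddCommGroup V] [Module k V] {ρ : V →ₗ[k] V ⊗[k] H}
    (hρ : IsRightCoaction k H ρ) :
    Module.finrank k (cotensor H ρ (Coalgebra.comul (R := k) (A := H))) = Module.finrank k V := by
  have hcounit : ∀ v, TensorProduct.rid k V
      ((Coalgebra.counit (R := k) (A := H)).lTensor V (ρ v)) = v :=
    LinearMap.congr_fun hρ.counit
  have hrange : cotensor H ρ (Coalgebra.comul (R := k) (A := H)) = LinearMap.range ρ := by
    ext x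
    rw [cotensor, LinearMap.mem_ker, LinearMap.sub_apply, sub_eq_zero]
    constructor
    · intro hx
      have h1 : ∀ y : V ⊗[k] H, TensorProduct.rid k _
          ((Coalgebra.counit (R := k) (A := H)).lTensor (V ⊗[k] H) (ρ.rTensor H y)) =
          ρ (TensorProduct.rid k _ ((Coalgebra.counit (R := k) (A := H)).lTensor V y)) :=
        fun y => by
          induction y with
          | zero => simp
          | tmul v h => simp
          | add x y hx hy => simp only [map_add, hx, hy]
      have h3 : ∀ (v : V) (z : H ⊗[k] H), TensorProduct.rid k _
          ((Coalgebra.counit (R := k) (A := H)).lTensor (V ⊗[k] H)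
            ((TensorProduct.assoc k V H H).symm (v ⊗ₜ z))) =
          v ⊗ₜ (TensorProduct.rid k _ ((Coalgebra.counit (R := k) (A := H)).lTensor H z)) :=
        fun v z => by
          induction z with
          | zero => simp
          | tmul h h' => simp
          | add x y hx hy => simp only [TensorProduct.tmul_add, map_add, hx, hy]
      have h2 : ∀ y : V ⊗[k] H, TensorProduct.rid k _
          ((Coalgebra.counit (R := k) (A := H)).lTensor (V ⊗[k] H)
            ((TensorProduct.assoc k V H H).symm
              ((Coalgebra.comul (R := k) (A := H)).lTensor V y))) = y := fun y => by
        induction y with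
        | zero => simp
        | tmul v h => rw [LinearMap.lTensor_tmul, h3]; simp
        | add x y hx hy => simp only [map_add, hx, hy]
      refine ⟨_, (h1 x).symm.trans ?_⟩
      rw [hx]
      exact h2 x
    · rintro ⟨v, rfl⟩
      exact (LinearEquiv.eq_symm_apply _).2 (LinearMap.congr_fun hρ.coassoc v)
  rw [hrange]
  exact LinearMap.finrank_range_of_inj fun v w hvw => by rw [← hcounit v, hvw, hcounit]

lemma finrank_cotensor_congr {V N : Type u} [AddCommGroup V] [Module k V] [AddCommGroup N]
    [Module k N] (ρ : V →ₗ[k] V ⊗[k] H) {lam : M →ₗ[k] H ⊗[k] M} {mu : N →ₗ[k] H ⊗[k] N}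
    (f : M ≃ₗ[k] N) (hf : IsLeftColinear H lam mu (f : M →ₗ[k] N)) :
    Module.finrank k (cotensor H ρ lam) = Module.finrank k (cotensor H ρ mu) := by
  have h : ∀ x : V ⊗[k] M, (ρ.rTensor N - (TensorProduct.assoc k V H N).symm.toLinearMap ∘ₗ
      mu.lTensor V) ((f : M →ₗ[k] N).lTensor V x) = (f : M →ₗ[k] N).lTensor (V ⊗[k] H)
      ((ρ.rTensor M - (TensorProduct.assoc k V H M).symm.toLinearMap ∘ₗ lam.lTensor V) x) := by
    intro x
    have h1 : ∀ (v : V) (z : H ⊗[k] M), (TensorProduct.assoc k V H N).symm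
        (v ⊗ₜ (f : M →ₗ[k] N).lTensor H z) = (f : M →ₗ[k] N).lTensor (V ⊗[k] H)
          ((TensorProduct.assoc k V H M).symm (v ⊗ₜ z)) := fun v z => by
      induction z with
      | zero => simp
      | tmul h h' => simp
      | add x y hx hy => simp only [TensorProduct.tmul_add, map_add, hx, hy]
    have h2 : ∀ m, mu (f m) = (f : M →ₗ[k] N).lTensor H (lam m) := LinearMap.congr_fun hf
    induction x with
    | zero => simp
    | tmul v m =>
      have h3 : (f : M →ₗ[k] N).lTensor (V ⊗[k] H) (ρ v ⊗ₜ m) = ρ v ⊗ₜ f m := rfl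
      simp [h2, h1]
    | add x y hx hy => simp only [map_add, hx, hy]
  have hcomap : cotensor H ρ lam =
      (cotensor H ρ mu).comap (f.lTensor V : V ⊗[k] M →ₗ[k] V ⊗[k] N) := by
    ext x
    rw [Submodule.mem_comap, cotensor, cotensor, LinearMap.mem_ker, LinearMap.mem_ker]
    refine Iff.trans ?_ (iff_of_eq (congrArg (· = 0) (h x))).symm
    exact ((f.lTensor (V ⊗[k] H)).map_eq_zero_iff).symm
  rw [hcomap]
  exact ((f.lTensor V).ofSubmodule' _).finrank_eq

end Coactions

section SliceModules

variable {k H M N : Type u} [Field k] [Ring H] [Bialgebra k H]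
  [AddCommGroup M] [Module k M] [AddCommGroup N] [Module k N]

variable (k H) in
/-- The free algebra on the functionals on `H`; it acts on every left `H`-comodule by
contraction. -/
abbrev SliceAlgebra : Type u := FreeAlgebra k (Module.Dual k H)

/-- The action of the free algebra on a left comodule by contraction. -/
noncomputable abbrev sliceModule (lam : M →ₗ[k] H ⊗[k] M) : Module (SliceAlgebra k H) M :=
  Module.compHom M (FreeAlgebra.lift k fun g : Module.Dual k H =>
    (slice g ∘ₗ lam : Module.End k M)).toRingHom

/-- The action of `SliceAlgebra k H` on `M` is the one given by contraction of `lam`. -/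
class IsSliceModule [Module (SliceAlgebra k H) M] (lam : M →ₗ[k] H ⊗[k] M) : Prop where
  ι_smul : ∀ (g : Module.Dual k H) (m : M), FreeAlgebra.ι k g • m = slice g (lam m)

lemma sliceModule_smul (lam : M →ₗ[k] H ⊗[k] M) (r : SliceAlgebra k H) (m : M) :
    (sliceModule lam).smul r m = FreeAlgebra.lift k
      (fun g : Module.Dual k H => (slice g ∘ₗ lam : Module.End k M)) r m := rfl

lemma isScalarTower_sliceModule (lam : M →ₗ[k] H ⊗[k] M) :
    let _ := sliceModule lam
    IsScalarTower k (SliceAlgebra k H) M := by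
  let _ := sliceModule lam
  exact IsScalarTower.of_algebraMap_smul fun c m => (sliceModule_smul lam _ m).trans <| by
    rw [AlgHom.commutes, Module.algebraMap_end_apply]

lemma isSliceModule_sliceModule (lam : M →ₗ[k] H ⊗[k] M) :
    let _ := sliceModule lam
    IsSliceModule lam := by
  let _ := sliceModule lam
  exact ⟨fun g m => (sliceModule_smul lam _ m).trans <| by
    rw [FreeAlgebra.lift_ι_apply, LinearMap.comp_apply]⟩

lemma isLeftColinear_of_linear [Module (SliceAlgebra k H) M]
    [Module (SliceAlgebra k H) N] {lam : M →ₗ[k] H ⊗[k] M} {mu : N →ₗ[k] H ⊗[k] N}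
    [IsSliceModule lam] [IsSliceModule mu] (u : M →ₗ[k] N)
    (hu : ∀ (r : SliceAlgebra k H) (m : M), u (r • m) = r • u m) :
    IsLeftColinear H lam mu u := by
  refine LinearMap.ext fun m => eq_of_slice_eq fun g => ?_
  rw [LinearMap.comp_apply, LinearMap.comp_apply, slice_lTensor,
    ← IsSliceModule.ι_smul (lam := mu), ← IsSliceModule.ι_smul (lam := lam), hu]

variable [Module (SliceAlgebra k H) M] [IsScalarTower k (SliceAlgebra k H) M]
  [Module (SliceAlgebra k H) N] [IsScalarTower k (SliceAlgebra k H) N]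

/-- A `k`-linear map commuting with contractions is linear over the free algebra. -/
def ofCommSlice (u : M →ₗ[k] N) (hu : ∀ (g : Module.Dual k H) (m : M),
      u (FreeAlgebra.ι k g • m) = FreeAlgebra.ι k g • u m) : M →ₗ[SliceAlgebra k H] N where
  toFun := u
  map_add' := u.map_add
  map_smul' r m := by
    rw [RingHom.id_apply]
    induction r using FreeAlgebra.induction generalizing m with
    | grade0 c => rw [algebraMap_smul, algebraMap_smul, u.map_smul]
    | grade1 g => exact hu g m
    | mul a b ha hb => rw [mul_smul, mul_smul, ha, hb]
    | add a b ha hb => rw [add_smul, add_smul, u.map_add, ha, hb]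

/-- A `k`-subspace stable under contractions, as a submodule over the free algebra. -/
def submoduleOfStable (P : Submodule k M)
    (hP : ∀ (g : Module.Dual k H), ∀ m ∈ P, FreeAlgebra.ι k g • m ∈ P) :
    Submodule (SliceAlgebra k H) M where
  toAddSubmonoid := P.toAddSubmonoid
  smul_mem' r m hm := by
    induction r using FreeAlgebra.induction generalizing m with
    | grade0 c => rw [algebraMap_smul]; exact P.smul_mem c hm
    | grade1 g => exact hP g m hm
    | mul a b ha hb => rw [mul_smul]; exact ha _ (hb m hm)
    | add a b ha hb => rw [add_smul]; exact P.add_mem (ha m hm) (hb m hm)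

/-- Every element of a comodule lies in a finite-dimensional subcomodule. -/
lemma exists_finite_submodule {lam : M →ₗ[k] H ⊗[k] M} (hlam : IsLeftCoaction k H lam)
    [IsSliceModule lam] (m : M) :
    ∃ T : Submodule (SliceAlgebra k H) M, m ∈ T ∧ Module.Finite k T := by
  refine ⟨submoduleOfStable (LinearMap.range (sliceAt (lam m))) ?_, ?_,
    finite_range_sliceAt (lam m)⟩
  · rintro g _ ⟨g', rfl⟩
    rw [IsSliceModule.ι_smul (lam := lam), sliceAt_apply, slice_slice_coaction hlam]
    exact ⟨_, rfl⟩
  · exact ⟨Coalgebra.counit, slice_counit_coaction hlam m⟩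

/-- The coalgebra is an injective comodule over itself. -/
lemma exists_extend_comul [Module (SliceAlgebra k H) H] [IsScalarTower k (SliceAlgebra k H) H]
    [IsSliceModule (Coalgebra.comul (R := k) (A := H))] {lam : M →ₗ[k] H ⊗[k] M}
    (hlam : IsLeftCoaction k H lam) [IsSliceModule lam] (P : Submodule (SliceAlgebra k H) M)
    (f : P →ₗ[SliceAlgebra k H] H) :
    ∃ F : M →ₗ[SliceAlgebra k H] H, F ∘ₗ P.subtype = f := by
  obtain ⟨φ, hφ⟩ := LinearMap.exists_extend (p := P.restrictScalars k)
    (Coalgebra.counit (R := k) (A := H) ∘ₗ f.restrictScalars k)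
  let F : M →ₗ[k] H := (TensorProduct.rid k H).toLinearMap ∘ₗ φ.lTensor H ∘ₗ lam
  have hF : ∀ (g : Module.Dual k H) (m : M), g (F m) = φ (FreeAlgebra.ι k g • m) := by
    intro g m
    rw [IsSliceModule.ι_smul (lam := lam)]
    change g (TensorProduct.rid k H (φ.lTensor H (lam m))) = _
    induction lam m with
    | zero => simp
    | tmul h m => simp [mul_comm]
    | add x y hx hy => simp only [map_add, hx, hy]
  have hsep : ∀ {x y : H}, (∀ g : Module.Dual k H, g x = g y) → x = y := fun {x y} h =>
    sub_eq_zero.1 ((Module.forall_dual_apply_eq_zero_iff k _).1 fun g => by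
      rw [map_sub, h, sub_self])
  have hFι : ∀ (g : Module.Dual k H) (m : M),
      F (FreeAlgebra.ι k g • m) = FreeAlgebra.ι k g • F m := fun g m => hsep fun g' => by
    rw [hF, IsSliceModule.ι_smul (lam := lam), IsSliceModule.ι_smul (lam := lam),
      slice_slice_coaction hlam, ← IsSliceModule.ι_smul, ← hF,
      IsSliceModule.ι_smul (lam := Coalgebra.comul (R := k) (A := H))]
    rfl
  refine ⟨ofCommSlice F hFι, LinearMap.ext fun p => hsep fun g => ?_⟩
  refine (hF g p).trans ?_
  have h1 : φ (FreeAlgebra.ι k g • (p : M)) =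
      Coalgebra.counit (R := k) (f (FreeAlgebra.ι k g • p)) :=
    LinearMap.congr_fun hφ (FreeAlgebra.ι k g • p)
  rw [h1, f.map_smul, IsSliceModule.ι_smul (lam := Coalgebra.comul (R := k) (A := H)),
    ← slice_lTensor, Coalgebra.lTensor_counit_comul]
  simp

/-- If `V ↦ V □_H N` preserves dimensions then `Hom(T, N)` has the dimension of `T` for every
finite-dimensional comodule `T`. -/
lemma finrank_hom_eq {lam : M →ₗ[k] H ⊗[k] M} (hlam : IsLeftCoaction k H lam)
    [IsSliceModule lam] {mu : N →ₗ[k] H ⊗[k] N} [IsSliceModule mu]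
    (hN : ∀ (V : Type u) [AddCommGroup V] [Module k V] [FiniteDimensional k V]
      (ρ : V →ₗ[k] V ⊗[k] H), IsRightCoaction k H ρ →
        Module.finrank k (cotensor H ρ mu) = Module.finrank k V)
    (T : Submodule (SliceAlgebra k H) M)
    (hT : Module.Finite k T) :
    Module.finrank k (T →ₗ[SliceAlgebra k H] N) = Module.finrank k T := by
  let i : T →ₗ[k] M := T.subtype.restrictScalars k
  obtain ⟨π, hπ⟩ := i.exists_leftInverse_of_injective
    (LinearMap.ker_eq_bot.2 T.subtype_injective)
  let lamT : T →ₗ[k] H ⊗[k] T := π.lTensor H ∘ₗ lam ∘ₗ i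
  have hlamT : ∀ (g : Module.Dual k H) (t : T), slice g (lamT t) = FreeAlgebra.ι k g • t := by
    intro g t
    change slice g (π.lTensor H (lam t)) = _
    rw [slice_lTensor, ← IsSliceModule.ι_smul (lam := lam)]
    exact LinearMap.congr_fun hπ (FreeAlgebra.ι k g • t)
  have hcoe : ∀ (g : Module.Dual k H) (t : T),
      ((slice g (lamT t) : T) : M) = slice g (lam t) := fun g t => by
    rw [hlamT, Submodule.coe_smul, IsSliceModule.ι_smul (lam := lam)]
  have hρ : IsRightCoaction k H (dualCoaction lamT) := isRightCoaction_dualCoaction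
    (fun g₁ g₂ t => Subtype.ext <| by
      rw [hcoe, hcoe, hcoe, slice_slice_coaction hlam])
    (fun t => Subtype.ext <| by rw [hcoe, slice_counit_coaction hlam])
  let e := dualTensorHomEquiv k T N
  let r := LinearMap.restrictScalarsₗ k (SliceAlgebra k H) T N k
  have hr : Function.Injective r := LinearMap.restrictScalars_injective k
  have hmap : (cotensor H (dualCoaction lamT) mu).map (e : _ →ₗ[k] _) = LinearMap.range r := by
    ext u
    rw [Submodule.mem_map_equiv, mem_cotensor_dualCoaction_iff]
    have hu : dualTensorHom k T N (e.symm u) = u := e.apply_symm_apply u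
    rw [hu]
    simp_rw [hlamT, ← IsSliceModule.ι_smul (lam := mu)]
    refine ⟨fun h => ⟨ofCommSlice u h, rfl⟩, ?_⟩
    rintro ⟨v, rfl⟩ g t
    exact v.map_smul _ t
  rw [← LinearMap.finrank_range_of_inj hr, ← hmap, LinearEquiv.finrank_map_eq, hN _ _ hρ,
    Subspace.dual_finrank_eq]

end SliceModules

end HopfGalois

open HopfGalois

/-- **Statement 5 (Etingof–Gelaki).** A left `H`-Galois object `A` is cleft if and only if
the fibre functor `V ↦ V □_H A` preserves dimensions of underlying vector spaces, i.e.
`dim (V □_H A) = dim V` for every finite-dimensional right `H`-comodule `V`. -/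
theorem cleft_iff_fibre_functor_preserves_dimensions
    (k : Type u) [Field k] (H : Type u) [Ring H] [HopfAlgebra k H]
    (A : Type u) [Ring A] [Algebra k A] (α : A →ₗ[k] H ⊗[k] A)
    (hA : IsLeftGaloisObject k H A α) :
    (∃ f : H ≃ₗ[k] A, IsLeftColinear H (Coalgebra.comul (R := k)) α (f : H →ₗ[k] A)) ↔
    (∀ (V : Type u) [AddCommGroup V] [Module k V] [FiniteDimensional k V]
      (ρ : V →ₗ[k] V ⊗[k] H), IsRightCoaction k H ρ →
        Module.finrank k ↥(cotensor H ρ α) = Module.finrank k V) := by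
  constructor
  · rintro ⟨f, hf⟩ V _ _ _ ρ hρ
    rw [← finrank_cotensor_congr ρ f hf, finrank_cotensor_comul hρ]
  · intro hdim
    have hα := hA.comodAlg.coaction
    have hΔ := isLeftCoaction_comul (k := k) (H := H)
    let _ := sliceModule α
    let _ := sliceModule (Coalgebra.comul (R := k) (A := H))
    have hsα : IsSliceModule α := isSliceModule_sliceModule α
    have hsΔ : IsSliceModule (Coalgebra.comul (R := k) (A := H)) := isSliceModule_sliceModule _
    have := isScalarTower_sliceModule α
    have := isScalarTower_sliceModule (Coalgebra.comul (R := k) (A := H))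
    have hdimH : ∀ (V : Type u) [AddCommGroup V] [Module k V] [FiniteDimensional k V]
      (ρ : V →ₗ[k] V ⊗[k] H), IsRightCoaction k H ρ → Module.finrank k
        (cotensor H ρ (Coalgebra.comul (R := k) (A := H))) = Module.finrank k V :=
      fun V _ _ _ ρ hρ => finrank_cotensor_comul hρ
    obtain ⟨F, hF⟩ := exists_bijective_of_finrank_hom (k := k) (exists_finite_submodule hα)
      (exists_finite_submodule hΔ) (exists_extend_comul hα)
      (finrank_hom_eq hα hdim) (finrank_hom_eq hα hdimH)
      (finrank_hom_eq hΔ hdim) (finrank_hom_eq hΔ hdimH)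
    let e := (LinearEquiv.ofBijective F hF).symm
    exact ⟨e.restrictScalars k, isLeftColinear_of_linear _ e.map_smul⟩
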